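/- arXiv:1901.09028 — 2 statements merged into one kernel-verified Lean document; each statement's English description precedes it below -/
import Mathlib

section
/- Let H be a separable complex Hilbert space and U a unitary operator on H having no eigenvectors (there is no nonzero f ∈ H and λ ∈ ℂ with U f = λ f). Let K : H → H be a bounded operator of finite rank, and set S = I + K where I is the identity operator. Then for every f ∈ H, (1/N) ∑_{i=1}^{N} U^{-i} S Uⁱ f → f in norm as N → ∞; that is, the averages (1/N) ∑_{i=1}^{N} U^{-i} S Uⁱ converge to the identity in the strong operator topology. -/
open Filter Topology

lemma aux_norm_sq_le {H : Type*} [NormedAddCommGroup H] [InnerProductSpace ℂ H]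
    [CompleteSpace H] (A : H →L[ℂ] H) (hA : A.IsPositive) (x : H) :
    ‖A x‖ ^ 2 ≤ ‖A‖ * (inner ℂ (A x) x).re := by
  rcases eq_or_ne A 0 with rfl | h0
  · simp
  have hn : 0 < ‖A‖ := norm_pos_iff.mpr h0
  set t : ℝ := ‖A‖⁻¹ with ht
  have h1 := hA.re_inner_nonneg_left (x - (t : ℂ) • A x)
  have h2 : (inner ℂ (A (A x)) (A x)).re ≤ ‖A‖ * ‖A x‖ ^ 2 := by
    calc _ ≤ ‖(inner ℂ (A (A x)) (A x))‖ := Complex.re_le_norm _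
      _ ≤ ‖A (A x)‖ * ‖A x‖ := norm_inner_le_norm _ _
      _ ≤ (‖A‖ * ‖A x‖) * ‖A x‖ := by gcongr; exact A.le_opNorm _
      _ = _ := by ring
  have h3 : inner ℂ (A (A x)) x = inner ℂ (A x) (A x) := hA.inner_left_eq_inner_right _ _
  have h4 : inner ℂ (A x) (A x) = ((‖A x‖ ^ 2 : ℝ) : ℂ) := by
    rw [inner_self_eq_norm_sq_to_K]; norm_cast
  simp only [map_sub, map_smul, inner_sub_left, inner_sub_right, inner_smul_left,
    inner_smul_right, h3, h4, Complex.conj_ofReal, RCLike.re_to_complex, Complex.sub_re,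
    Complex.re_ofReal_mul, Complex.ofReal_re] at h1
  have h5 : t * ‖A‖ = 1 := inv_mul_cancel₀ hn.ne'
  have htp : 0 < t := inv_pos.mpr hn
  have h6 : t * (t * (inner ℂ (A (A x)) (A x)).re) ≤ t * ‖A x‖ ^ 2 := by
    gcongr
    calc _ ≤ t * (‖A‖ * ‖A x‖ ^ 2) := by gcongr
      _ = _ := by rw [← mul_assoc, h5, one_mul]
  have h7 : t * ‖A x‖ ^ 2 ≤ (inner ℂ (A x) x).re := by nlinarith
  calc ‖A x‖ ^ 2 = ‖A‖ * (t * ‖A x‖ ^ 2) := by rw [← mul_assoc, mul_comm ‖A‖, h5, one_mul]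
    _ ≤ _ := by gcongr

lemma aux_compact {H : Type*} [NormedAddCommGroup H] [InnerProductSpace ℂ H]
    [CompleteSpace H] (A : H →L[ℂ] H) (hA : A.IsPositive) (C : ℝ)
    (hC : ∀ (n : ℕ) (e : Fin n → H), Orthonormal ℂ e → ∑ k, (inner ℂ (A (e k)) (e k)).re ≤ C) :
    IsCompactOperator A := by
  have hcl := isClosed_setOfPred_isCompactOperator (σ₁₂ := RingHom.id ℂ) (M₁ := H) (M₂ := H)
  have key : A ∈ closure {f : H →L[ℂ] H | IsCompactOperator f} := by
    rw [Metric.mem_closure_iff]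
    intro δ hδ
    -- the set of partial traces
    let T : Set ℝ := {r | ∃ (n : ℕ) (e : Fin n → H), Orthonormal ℂ e ∧
      r = ∑ k, (inner ℂ (A (e k)) (e k)).re}
    have hTne : T.Nonempty := ⟨0, 0, Fin.elim0, ⟨fun i => i.elim0, fun i => i.elim0⟩, by simp⟩
    have hTb : BddAbove T := ⟨C, by rintro r ⟨n, e, he, rfl⟩; exact hC n e he⟩
    obtain ⟨ε, hε, hεδ⟩ : ∃ ε : ℝ, 0 < ε ∧ ‖A‖ * ε < (δ / 2) ^ 2 := by
      refine ⟨(δ / 2) ^ 2 / (‖A‖ + 1), by positivity, ?_⟩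
      rw [mul_div_assoc', div_lt_iff₀ (by positivity)]
      nlinarith [sq_pos_of_pos (half_pos hδ)]
    obtain ⟨r, ⟨n, e, he, rfl⟩, hr⟩ := exists_lt_of_lt_csSup hTne (sub_lt_self (sSup T) hε)
    let S : Submodule ℂ H := Submodule.span ℂ (Set.range e)
    have : FiniteDimensional ℂ S := FiniteDimensional.span_of_finite ℂ (Set.finite_range e)
    have hunit : ∀ x : H, ‖x‖ = 1 → x ∈ Sᗮ → (inner ℂ (A x) x).re ≤ ε := by
      intro x hx hxS
      have hort : ∀ k, inner ℂ (e k) x = 0 := fun k =>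
        (Submodule.mem_orthogonal S x).1 hxS _ (Submodule.subset_span ⟨k, rfl⟩)
      have hort' : ∀ k, inner ℂ x (e k) = 0 := fun k => inner_eq_zero_symm.1 (hort k)
      have ho : Orthonormal ℂ (Fin.cons x e : Fin (n + 1) → H) := by
        refine ⟨fun i => ?_, fun i j hij => ?_⟩
        · refine Fin.cases ?_ (fun k => ?_) i
          · simpa using hx
          · simpa using he.1 k
        · revert hij
          refine Fin.cases ?_ (fun k => ?_) i <;> refine Fin.cases ?_ (fun l => ?_) j
          · simp
          · intro _; simpa using hort' l
          · intro _; simpa using hort k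
          · intro h
            simpa using he.2 (fun h' => h (by rw [h']))
      have hle := le_csSup hTb ⟨n + 1, _, ho, rfl⟩
      rw [Fin.sum_univ_succ] at hle
      simp only [Fin.cons_zero, Fin.cons_succ] at hle
      linarith
    have hall : ∀ x : H, x ∈ Sᗮ → (inner ℂ (A x) x).re ≤ ε * ‖x‖ ^ 2 := by
      intro x hxS
      rcases eq_or_ne x 0 with rfl | hx
      · simp
      have hnx : 0 < ‖x‖ := norm_pos_iff.mpr hx
      have h1 := hunit (((‖x‖⁻¹ : ℝ) : ℂ) • x) (by
        rw [norm_smul, Complex.norm_real, norm_inv, norm_norm, inv_mul_cancel₀ hnx.ne'])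
        (Sᗮ.smul_mem _ hxS)
      simp only [map_smul, inner_smul_left, inner_smul_right, Complex.conj_ofReal,
        Complex.re_ofReal_mul] at h1
      calc (inner ℂ (A x) x).re = (‖x‖⁻¹ * (‖x‖⁻¹ * (inner ℂ (A x) x).re)) * ‖x‖ ^ 2 := by
            field_simp
        _ ≤ _ := by gcongr
    refine ⟨A.comp S.starProjection, ?_, ?_⟩
    · have := FiniteDimensional.proper ℂ S
      exact (isCompactOperator_of_locallyCompactSpace_rng (A.comp S.subtypeL)).comp_clm
        S.orthogonalProjectionOnto
    · rw [dist_eq_norm]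
      refine lt_of_le_of_lt (ContinuousLinearMap.opNorm_le_bound _ (half_pos hδ).le ?_)
        (half_lt_self hδ)
      intro x
      have e1 : (A - A.comp S.starProjection) x = A (x - S.starProjection x) := by simp
      rw [e1]
      set y := x - S.starProjection x with hy
      have hyS : y ∈ Sᗮ := S.sub_starProjection_mem_orthogonal x
      have hyx : ‖y‖ ≤ ‖x‖ := by
        have h := Submodule.norm_starProjection_apply_le Sᗮ x
        rwa [Submodule.starProjection_orthogonal_val] at h
      refine (sq_le_sq₀ (norm_nonneg _) (by positivity)).1 ?_
      calc ‖A y‖ ^ 2 ≤ ‖A‖ * (inner ℂ (A y) y).re := aux_norm_sq_le A hA y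
        _ ≤ ‖A‖ * (ε * ‖y‖ ^ 2) := by gcongr; exact hall y hyS
        _ = (‖A‖ * ε) * ‖y‖ ^ 2 := by ring
        _ ≤ (δ / 2) ^ 2 * ‖x‖ ^ 2 := by gcongr
        _ = _ := by ring
  rw [hcl.closure_eq] at key
  exact key

lemma aux_zero {H : Type*} [NormedAddCommGroup H] [InnerProductSpace ℂ H]
    [CompleteSpace H] (U : H ≃ₗᵢ[ℂ] H)
    (hU : ¬∃ (f : H) (lam : ℂ), f ≠ 0 ∧ U f = lam • f)
    (A : H →L[ℂ] H) (hA : A.IsPositive) (C : ℝ)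
    (hC : ∀ (n : ℕ) (e : Fin n → H), Orthonormal ℂ e → ∑ k, (inner ℂ (A (e k)) (e k)).re ≤ C)
    (hAU : ∀ x, A (U x) = U (A x)) : A = 0 := by
  have hc := aux_compact A hA C hC
  rw [← ContinuousLinearMap.eq_zero_of_forall_hasEigenvalue_eq_zero hc hA.isSymmetric]
  intro μ hμ
  by_contra hμ0
  have hfd := ContinuousLinearMap.finite_dimensional_eigenspace hc μ hμ0
  let V := Module.End.eigenspace (A : H →ₗ[ℂ] H) μ
  have hinv : ∀ x ∈ V, (U.toLinearEquiv : H →ₗ[ℂ] H) x ∈ V := by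
    intro x hx
    rw [Module.End.mem_eigenspace_iff] at hx ⊢
    have hx' : A x = μ • x := hx
    change A (U x) = μ • U x
    rw [hAU, hx', map_smul]
  have hnt : Nontrivial V := Submodule.nontrivial_iff_ne_bot.2 hμ
  obtain ⟨c, hc⟩ := Module.End.exists_eigenvalue
    ((U.toLinearEquiv : H →ₗ[ℂ] H).restrict hinv)
  obtain ⟨v, hv⟩ := hc.exists_hasEigenvector
  refine hU ⟨v, c, fun h => hv.2 (Subtype.ext h), ?_⟩
  exact congrArg Subtype.val hv.apply_eq_smul

lemma aux_hs {H : Type*} [NormedAddCommGroup H] [InnerProductSpace ℂ H]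
    [CompleteSpace H] (K : H →L[ℂ] H)
    (hK : FiniteDimensional ℂ (LinearMap.range (K : H →ₗ[ℂ] H))) :
    ∃ C : ℝ, ∀ (n : ℕ) (e : Fin n → H), Orthonormal ℂ e → ∑ k, ‖K (e k)‖ ^ 2 ≤ C := by
  let R := LinearMap.range (K : H →ₗ[ℂ] H)
  let b := stdOrthonormalBasis ℂ R
  refine ⟨∑ j, ‖K.adjoint (b j : H)‖ ^ 2, fun n e he => ?_⟩
  have h1 : ∀ x, ‖K x‖ ^ 2 = ∑ j, ‖inner ℂ x (K.adjoint (b j : H))‖ ^ 2 := by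
    intro x
    have h := b.sum_sq_norm_inner_right (⟨K x, ⟨x, rfl⟩⟩ : R)
    have h2 : ‖(⟨K x, ⟨x, rfl⟩⟩ : R)‖ = ‖K x‖ := rfl
    rw [h2] at h
    rw [← h]
    refine Finset.sum_congr rfl fun j _ => ?_
    rw [ContinuousLinearMap.adjoint_inner_right, norm_inner_symm]
    rfl
  simp_rw [h1]
  rw [Finset.sum_comm]
  exact Finset.sum_le_sum fun j _ => he.sum_inner_products_le _

/-- averaged forms -/
noncomputable def auxQ {H : Type*} [NormedAddCommGroup H] [InnerProductSpace ℂ H]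
    (U : H ≃ₗᵢ[ℂ] H) (K : H →L[ℂ] H) (N : ℕ) (x y : H) : ℂ :=
  (N : ℂ)⁻¹ * ∑ i ∈ Finset.Icc 1 N, inner ℂ (K ((⇑U)^[i] x)) (K ((⇑U)^[i] y))

section
variable {H : Type*} [NormedAddCommGroup H] [InnerProductSpace ℂ H]
    (U : H ≃ₗᵢ[ℂ] H) (K : H →L[ℂ] H)

lemma aux_iter_add (i : ℕ) (x y : H) : (⇑U)^[i] (x + y) = (⇑U)^[i] x + (⇑U)^[i] y := by
  induction i with
  | zero => rfl
  | succ i ih => simp only [Function.iterate_succ_apply', ih, map_add]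

lemma aux_iter_smul (i : ℕ) (c : ℂ) (x : H) : (⇑U)^[i] (c • x) = c • (⇑U)^[i] x := by
  induction i with
  | zero => rfl
  | succ i ih => simp only [Function.iterate_succ_apply', ih, map_smul]

lemma aux_iter_norm (i : ℕ) (x : H) : ‖(⇑U)^[i] x‖ = ‖x‖ := by
  induction i with
  | zero => rfl
  | succ i ih => simp only [Function.iterate_succ_apply', ih, LinearIsometryEquiv.norm_map]

lemma aux_iter_inner (i : ℕ) (x y : H) :
    inner ℂ ((⇑U)^[i] x) ((⇑U)^[i] y) = inner ℂ x y := by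
  induction i with
  | zero => rfl
  | succ i ih => simp only [Function.iterate_succ_apply', ih, LinearIsometryEquiv.inner_map_map]

lemma aux_avg_le (N : ℕ) (g : ℕ → ℝ) (C : ℝ) (hC : 0 ≤ C) (h : ∀ i, g i ≤ C) :
    (N : ℝ)⁻¹ * ∑ i ∈ Finset.Icc 1 N, g i ≤ C := by
  rcases Nat.eq_zero_or_pos N with rfl | hN
  · simpa using hC
  have hN' : (0 : ℝ) < N := by exact_mod_cast hN
  rw [inv_mul_le_iff₀ hN']
  refine (Finset.sum_le_card_nsmul _ _ C fun i _ => h i).trans ?_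
  simp

lemma aux_term_bound (i : ℕ) (x y : H) :
    ‖inner ℂ (K ((⇑U)^[i] x)) (K ((⇑U)^[i] y))‖ ≤ ‖K‖ ^ 2 * ‖x‖ * ‖y‖ := by
  calc _ ≤ ‖K ((⇑U)^[i] x)‖ * ‖K ((⇑U)^[i] y)‖ := norm_inner_le_norm _ _
    _ ≤ (‖K‖ * ‖(⇑U)^[i] x‖) * (‖K‖ * ‖(⇑U)^[i] y‖) := by
        gcongr <;> exact K.le_opNorm _
    _ = _ := by rw [aux_iter_norm, aux_iter_norm]; ring

lemma auxQ_bound (N : ℕ) (x y : H) : ‖auxQ U K N x y‖ ≤ ‖K‖ ^ 2 * ‖x‖ * ‖y‖ := by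
  unfold auxQ
  rw [norm_mul, norm_inv, Complex.norm_natCast]
  refine le_trans ?_ (aux_avg_le N (fun i => ‖inner ℂ (K ((⇑U)^[i] x)) (K ((⇑U)^[i] y))‖) _
    (by positivity) fun i => aux_term_bound U K i x y)
  gcongr
  exact norm_sum_le _ _

lemma auxQ_add_left (N : ℕ) (x x' y : H) :
    auxQ U K N (x + x') y = auxQ U K N x y + auxQ U K N x' y := by
  simp only [auxQ, aux_iter_add, map_add, inner_add_left, Finset.sum_add_distrib, mul_add]

lemma auxQ_add_right (N : ℕ) (x y y' : H) :
    auxQ U K N x (y + y') = auxQ U K N x y + auxQ U K N x y' := by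
  simp only [auxQ, aux_iter_add, map_add, inner_add_right, Finset.sum_add_distrib, mul_add]

lemma auxQ_smul_left (N : ℕ) (c : ℂ) (x y : H) :
    auxQ U K N (c • x) y = (starRingEnd ℂ) c * auxQ U K N x y := by
  simp only [auxQ, aux_iter_smul, map_smul, inner_smul_left, ← Finset.mul_sum]
  ring

lemma auxQ_smul_right (N : ℕ) (c : ℂ) (x y : H) :
    auxQ U K N x (c • y) = c * auxQ U K N x y := by
  simp only [auxQ, aux_iter_smul, map_smul, inner_smul_right, ← Finset.mul_sum]
  ring

lemma auxQ_conj (N : ℕ) (x y : H) :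
    (starRingEnd ℂ) (auxQ U K N x y) = auxQ U K N y x := by
  simp [auxQ, map_sum, inner_conj_symm]

lemma auxQ_self (N : ℕ) (x : H) : auxQ U K N x x =
    (((N : ℝ)⁻¹ * ∑ i ∈ Finset.Icc 1 N, ‖K ((⇑U)^[i] x)‖ ^ 2 : ℝ) : ℂ) := by
  simp only [auxQ, inner_self_eq_norm_sq_to_K]
  push_cast
  rfl

lemma auxQ_shift (N : ℕ) (x y : H) :
    ‖auxQ U K N (U x) (U y) - auxQ U K N x y‖ ≤ (N : ℝ)⁻¹ * (2 * (‖K‖ ^ 2 * ‖x‖ * ‖y‖)) := by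
  let g : ℕ → ℂ := fun i => inner ℂ (K ((⇑U)^[i] x)) (K ((⇑U)^[i] y))
  have h : ∑ i ∈ Finset.Icc 1 N, g (i + 1) - ∑ i ∈ Finset.Icc 1 N, g i = g (N + 1) - g 1 := by
    induction N with
    | zero => simp
    | succ n ih =>
      rw [Finset.sum_Icc_succ_top (by omega), Finset.sum_Icc_succ_top (by omega)]
      linear_combination ih
  have h2 : auxQ U K N (U x) (U y) - auxQ U K N x y = (N : ℂ)⁻¹ * (g (N + 1) - g 1) := by
    rw [← h]
    simp only [auxQ, g, Function.iterate_succ_apply]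
    ring
  rw [h2, norm_mul, norm_inv, Complex.norm_natCast]
  gcongr
  refine (norm_sub_le _ _).trans ?_
  have a1 := aux_term_bound U K (N + 1) x y
  have a2 := aux_term_bound U K 1 x y
  simp only [g]
  linarith

lemma aux_main [CompleteSpace H]
    (hU : ¬∃ (f : H) (lam : ℂ), f ≠ 0 ∧ U f = lam • f)
    (hK : FiniteDimensional ℂ (LinearMap.range (K : H →ₗ[ℂ] H))) (f : H) :
    Tendsto (fun N => auxQ U K N f f) atTop (𝓝 0) := by
  rw [tendsto_iff_ultrafilter]
  intro g hg
  have hex : ∀ x y : H, ∃ z : ℂ, Tendsto (fun N => auxQ U K N x y) g (𝓝 z) := by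
    intro x y
    have hb : ((g.map fun N => auxQ U K N x y : Ultrafilter ℂ) : Filter ℂ) ≤
        𝓟 (Metric.closedBall 0 (‖K‖ ^ 2 * ‖x‖ * ‖y‖)) := by
      rw [le_principal_iff]
      refine Filter.mem_map.2 (Filter.univ_mem' fun N => ?_)
      simpa using auxQ_bound U K N x y
    obtain ⟨z, -, hz⟩ := (isCompact_closedBall (0 : ℂ) _).ultrafilter_le_nhds _ hb
    exact ⟨z, hz⟩
  choose L hL using hex
  let B : H →L⋆[ℂ] H →L[ℂ] ℂ := (LinearMap.mk₂'ₛₗ (starRingEnd ℂ) (RingHom.id ℂ) L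
    (fun x x' y => tendsto_nhds_unique (hL _ _) (by
      simpa only [auxQ_add_left] using (hL x y).add (hL x' y)))
    (fun c x y => tendsto_nhds_unique (hL _ _) (by
      simpa only [auxQ_smul_left, smul_eq_mul] using (hL x y).const_mul (starRingEnd ℂ c)))
    (fun x y y' => tendsto_nhds_unique (hL _ _) (by
      simpa only [auxQ_add_right] using (hL x y).add (hL x y')))
    (fun c x y => tendsto_nhds_unique (hL _ _) (by
      simpa only [auxQ_smul_right, smul_eq_mul, RingHom.id_apply] using (hL x y).const_mul c))).mkContinuous₂ (‖K‖ ^ 2)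
    (fun x y => le_of_tendsto (hL x y).norm (Eventually.of_forall fun N => auxQ_bound U K N x y))
  let A : H →L[ℂ] H := InnerProductSpace.continuousLinearMapOfBilin B
  have hAL : ∀ x y, inner ℂ (A x) y = L x y := fun x y =>
    InnerProductSpace.continuousLinearMapOfBilin_apply B x y
  have hre : ∀ x, Tendsto (fun N : ℕ => (N : ℝ)⁻¹ * ∑ i ∈ Finset.Icc 1 N, ‖K ((⇑U)^[i] x)‖ ^ 2)
      g (𝓝 (L x x).re) := by
    intro x
    have := (Complex.continuous_re.tendsto _).comp (hL x x)
    refine this.congr fun N => ?_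
    simp only [Function.comp, auxQ_self, Complex.ofReal_re]
  have hpos : A.IsPositive := by
    refine ⟨fun x y => ?_, fun x => ?_⟩
    · change inner ℂ (A x) y = inner ℂ x (A y)
      rw [← inner_conj_symm x, hAL, hAL]
      refine tendsto_nhds_unique (hL x y) ?_
      have := (Complex.continuous_conj.tendsto _).comp (hL y x)
      refine this.congr fun N => ?_
      simp only [Function.comp, auxQ_conj]
    · change 0 ≤ (inner ℂ (A x) x).re
      rw [hAL]
      exact ge_of_tendsto (hre x) (Eventually.of_forall fun N => by positivity)
  obtain ⟨C, hC⟩ := aux_hs K hK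
  have hC0 : 0 ≤ C := by
    simpa using hC 0 Fin.elim0 ⟨fun i => i.elim0, fun i => i.elim0⟩
  have htr : ∀ (n : ℕ) (e : Fin n → H), Orthonormal ℂ e →
      ∑ k, (inner ℂ (A (e k)) (e k)).re ≤ C := by
    intro n e he
    simp_rw [hAL]
    refine le_of_tendsto (tendsto_finsetSum Finset.univ fun k _ => hre (e k))
      (Eventually.of_forall fun N => ?_)
    rw [← Finset.mul_sum, Finset.sum_comm]
    refine aux_avg_le N _ C hC0 fun i => hC n (fun k => (⇑U)^[i] (e k)) ?_
    refine ⟨fun k => ?_, fun k l hkl => ?_⟩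
    · rw [aux_iter_norm]; exact he.1 k
    · change inner ℂ _ _ = 0
      rw [aux_iter_inner]; exact he.2 hkl
  have hLU : ∀ x y, L (U x) (U y) = L x y := by
    intro x y
    have h1 := (hL (U x) (U y)).sub (hL x y)
    have h2 : Tendsto (fun N => auxQ U K N (U x) (U y) - auxQ U K N x y) g (𝓝 0) := by
      refine squeeze_zero_norm (auxQ_shift U K · x y) ?_
      have := (tendsto_inv_atTop_nhds_zero_nat (𝕜 := ℝ)).mul_const (2 * (‖K‖ ^ 2 * ‖x‖ * ‖y‖))
      rw [zero_mul] at this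
      exact this.mono_left hg
    exact sub_eq_zero.1 (tendsto_nhds_unique h1 h2)
  have hAU : ∀ x, A (U x) = U (A x) := by
    intro x
    refine ext_inner_right ℂ fun y => ?_
    obtain ⟨z, rfl⟩ := U.surjective y
    rw [LinearIsometryEquiv.inner_map_map, hAL, hAL, hLU]
  have hA0 := aux_zero U hU A hpos C htr hAU
  have : L f f = 0 := by rw [← hAL, hA0]; simp
  rw [← this]
  exact hL f f

end

lemma aux_symm_iter {H : Type*} [NormedAddCommGroup H] [InnerProductSpace ℂ H]
    (U : H ≃ₗᵢ[ℂ] H) (i : ℕ) (x : H) : (⇑U.symm)^[i] ((⇑U)^[i] x) = x :=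
  Function.LeftInverse.iterate (fun y => U.symm_apply_apply y) i x

/-- If `U` is a unitary operator with no eigenvectors on a separable complex Hilbert
space `H`, `K` is a bounded finite-rank operator and `S = I + K`, then the averages
`(1/N) ∑_{i=1}^{N} U⁻ⁱ S Uⁱ` converge to the identity in the strong operator topology:
for every `f ∈ H`, `(1/N) ∑_{i=1}^{N} U⁻ⁱ S Uⁱ f → f` in norm. -/
theorem statement8 {H : Type*} [NormedAddCommGroup H] [InnerProductSpace ℂ H]
    [CompleteSpace H] [TopologicalSpace.SeparableSpace H]
    (U : H ≃ₗᵢ[ℂ] H)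
    (hU : ¬∃ (f : H) (lam : ℂ), f ≠ 0 ∧ U f = lam • f)
    (K : H →L[ℂ] H) (hK : FiniteDimensional ℂ (LinearMap.range (K : H →ₗ[ℂ] H)))
    (f : H) :
    Tendsto (fun N : ℕ =>
        (N : ℝ)⁻¹ • ∑ i ∈ Finset.Icc 1 N,
          (⇑U.symm)^[i] (((⇑U)^[i] f) + K ((⇑U)^[i] f)))
      atTop (𝓝 f) := by
  have hQ := (Complex.continuous_re.tendsto _).comp (aux_main U K hU hK f)
  have hsq : Tendsto (fun N : ℕ => (N : ℝ)⁻¹ * ∑ i ∈ Finset.Icc 1 N, ‖K ((⇑U)^[i] f)‖ ^ 2)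
      atTop (𝓝 0) := by
    refine hQ.congr fun N => ?_
    simp only [Function.comp, auxQ_self, Complex.ofReal_re]
  have hsqrt := (Real.continuous_sqrt.tendsto _).comp hsq
  rw [Real.sqrt_zero] at hsqrt
  rw [tendsto_iff_norm_sub_tendsto_zero]
  refine squeeze_zero' (Eventually.of_forall fun N => norm_nonneg _) ?_ hsqrt
  filter_upwards [eventually_gt_atTop 0] with N hN
  have hN' : (0 : ℝ) < N := by exact_mod_cast hN
  have e1 : (N : ℝ)⁻¹ • ∑ i ∈ Finset.Icc 1 N,
      (⇑U.symm)^[i] (((⇑U)^[i] f) + K ((⇑U)^[i] f)) - f =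
      (N : ℝ)⁻¹ • ∑ i ∈ Finset.Icc 1 N, (⇑U.symm)^[i] (K ((⇑U)^[i] f)) := by
    simp only [aux_iter_add, aux_symm_iter, Finset.sum_add_distrib, smul_add]
    have : (N : ℝ)⁻¹ • ∑ i ∈ Finset.Icc 1 N, f = f := by
      rw [Finset.sum_const, Nat.card_Icc, Nat.add_sub_cancel, ← Nat.cast_smul_eq_nsmul ℝ,
        smul_smul, inv_mul_cancel₀ hN'.ne', one_smul]
    rw [this, add_sub_cancel_left]
  rw [e1, norm_smul, norm_inv, Real.norm_natCast]
  apply Real.le_sqrt_of_sq_le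
  calc ((N : ℝ)⁻¹ * ‖∑ i ∈ Finset.Icc 1 N, (⇑U.symm)^[i] (K ((⇑U)^[i] f))‖) ^ 2
      ≤ ((N : ℝ)⁻¹ * ∑ i ∈ Finset.Icc 1 N, ‖K ((⇑U)^[i] f)‖) ^ 2 := by
        gcongr
        refine (norm_sum_le _ _).trans (le_of_eq ?_)
        simp only [aux_iter_norm]
    _ = (N : ℝ)⁻¹ ^ 2 * (∑ i ∈ Finset.Icc 1 N, ‖K ((⇑U)^[i] f)‖) ^ 2 := by ring
    _ ≤ (N : ℝ)⁻¹ ^ 2 * (N * ∑ i ∈ Finset.Icc 1 N, ‖K ((⇑U)^[i] f)‖ ^ 2) := by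
        gcongr
        have := sq_sum_le_card_mul_sum_sq (s := Finset.Icc 1 N)
          (f := fun i => ‖K ((⇑U)^[i] f)‖)
        simpa using this
    _ = _ := by field_simp
end

section
/- For any infinite sets C' ⊆ ℕ and D' ⊆ ℕ there exist infinite subsets C ⊆ C' and D ⊆ D', a σ-finite measure space (X, μ) with μ(X) = ∞, and ergodic automorphisms S̄ and T̄ of (X, μ) such that for all measurable sets A and B of finite measure: μ(S̄ⁱ(A) ∩ B) → 0 and μ(T̄ⁱ(A) Δ A) → 0 as i → ∞ along i ∈ C, while μ(S̄ⁱ(A) Δ A) → 0 and μ(T̄ⁱ(A) ∩ B) → 0 as i → ∞ along i ∈ D. -/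
open MeasureTheory Filter Topology
open scoped symmDiff ENNReal

/-- An automorphism `T` of `(X, μ)` is ergodic if every measurable `A` with
`μ(T⁻¹(A) ∆ A) = 0` satisfies `μ A = 0` or `μ (X \ A) = 0`. -/
def ErgodicAut {X : Type*} [MeasurableSpace X] (μ : Measure X) (T : X ≃ᵐ X) : Prop :=
  ∀ A : Set X, MeasurableSet A → μ ((⇑T ⁻¹' A) ∆ A) = 0 → μ A = 0 ∨ μ Aᶜ = 0


namespace RankOne

open scoped NNReal

/-- number of cells of stage `n` in a unit interval -/
def R (n : ℕ) : ℕ := (n + 1).factorial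

lemma R_pos (n : ℕ) : 0 < R n := Nat.factorial_pos _

lemma R_succ (n : ℕ) : R (n + 1) = (n + 2) * R n := by
  simp [R, Nat.factorial_succ]

lemma R_ne (n : ℕ) : (R n : ℝ≥0) ≠ 0 := by
  exact_mod_cast (R_pos n).ne'

/-- position of the cell of stage `n` containing `x` -/
noncomputable def p (n : ℕ) (x : ℝ≥0) : ℕ := ⌊x * (R n : ℝ≥0)⌋₊

/-- move `x` to the cell `q` of stage `n` by a translation -/
noncomputable def mv (n q : ℕ) (x : ℝ≥0) : ℝ≥0 := (q + (x * (R n : ℝ≥0) - p n x)) / R n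

lemma p_succ_div (n : ℕ) (x : ℝ≥0) : p (n + 1) x / (n + 2) = p n x := by
  unfold p
  rw [R_succ]
  have := Nat.mul_cast_floor_div_cancel (n := n + 2) (by omega) (x * (R n : ℝ≥0))
  rw [← this]
  congr 2
  push_cast
  ring

lemma p_eq (n : ℕ) (x : ℝ≥0) :
    p (n + 1) x = (n + 2) * p n x + p (n + 1) x % (n + 2) := by
  rw [← p_succ_div n, Nat.div_add_mod]

lemma p_le (n : ℕ) (x : ℝ≥0) : (p n x : ℝ≥0) ≤ x * R n := Nat.floor_le (by positivity)

lemma p_lt (n : ℕ) (x : ℝ≥0) : x * R n < p n x + 1 := Nat.lt_floor_add_one _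

lemma p_mv (n q : ℕ) (x : ℝ≥0) : p n (mv n q x) = q := by
  have h1 : x * R n - p n x < 1 := by
    rw [tsub_lt_iff_left (p_le n x)]
    exact p_lt n x
  unfold p mv
  rw [div_mul_cancel₀ _ (R_ne n), Nat.floor_eq_iff (by positivity)]
  constructor
  · simp
  · gcongr

lemma mv_self (n : ℕ) (x : ℝ≥0) : mv n (p n x) x = x := by
  unfold mv
  rw [add_tsub_cancel_of_le (p_le n x), mul_div_cancel_right₀ _ (R_ne n)]

lemma mv_mv (n q q' : ℕ) (x : ℝ≥0) : mv n q' (mv n q x) = mv n q' x := by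
  rw [mv, p_mv]
  unfold mv
  rw [div_mul_cancel₀ _ (R_ne n), add_tsub_cancel_left]

lemma mv_succ (n q : ℕ) (x : ℝ≥0) :
    mv (n + 1) ((n + 2) * q + p (n + 1) x % (n + 2)) x = mv n q x := by
  have h1 := p_eq n x
  generalize p (n + 1) x % (n + 2) = j at *
  have h3 := R_ne n
  have h4 := R_ne (n + 1)
  have e1 := p_le n x
  have e2 := p_le (n + 1) x
  unfold mv
  rw [div_eq_div_iff h4 h3]
  apply NNReal.eq
  push_cast [NNReal.coe_sub e1, NNReal.coe_sub e2]
  rw [h1, R_succ]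
  push_cast
  ring

lemma measurable_p (n : ℕ) : Measurable (p n) := by
  unfold p
  exact Nat.measurable_floor.comp (by fun_prop)

lemma measurable_mv (n q : ℕ) : Measurable (mv n q) := by
  unfold mv
  have := measurable_p n
  have h2 : Measurable fun x => (p n x : ℝ≥0) := (measurable_from_top (f := fun k : ℕ => (k : ℝ≥0))).comp this
  fun_prop

lemma tendsto_p (x : ℝ≥0) : Tendsto (fun n => (p n x : ℝ≥0) / R n) atTop (𝓝 x) := by
  have h1 : Tendsto (fun n => R n) atTop atTop := by
    apply tendsto_atTop_mono (f := fun n => n) _ tendsto_id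
    intro n
    exact le_trans (Nat.le_succ n) (Nat.self_le_factorial _)
  have h3 : Tendsto (fun n => (R n : ℝ)) atTop atTop := tendsto_natCast_atTop_atTop.comp h1
  have h4 := (tendsto_nat_floor_mul_div_atTop (R := ℝ) (a := (x : ℝ)) (by positivity)).comp h3
  rw [← NNReal.tendsto_coe]
  refine h4.congr ?_
  intro n
  have : ⌊(x : ℝ) * (R n : ℝ)⌋₊ = p n x := by
    rw [Nat.floor_eq_iff (by positivity)]
    exact ⟨by exact_mod_cast p_le n x, by exact_mod_cast p_lt n x⟩
  simp [this]

/-- cells -/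
def cell (n q : ℕ) : Set ℝ≥0 := {x | p n x = q}

lemma measurableSet_cell (n q : ℕ) : MeasurableSet (cell n q) :=
  measurable_p n (measurableSet_singleton q)

lemma emb : MeasurableEmbedding ((↑) : ℝ≥0 → ℝ) :=
  MeasurableEmbedding.subtype_coe measurableSet_Ici

/-- Lebesgue measure on the half-line -/
noncomputable def vol : Measure ℝ≥0 := Measure.comap ((↑) : ℝ≥0 → ℝ) volume

lemma volume_cell (n q : ℕ) : vol (cell n q) = (R n : ℝ≥0∞)⁻¹ := by
  have h0 : (0:ℝ) < R n := by exact_mod_cast R_pos n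
  have h1 : ((↑) : ℝ≥0 → ℝ) '' (cell n q) = Set.Ico ((q : ℝ) / R n) ((q + 1) / R n) := by
    ext y
    simp only [cell, p, Set.mem_image, Set.mem_ofPred_eq, Set.mem_Ico]
    constructor
    · rintro ⟨x, hx, rfl⟩
      rw [Nat.floor_eq_iff (by positivity)] at hx
      rw [div_le_iff₀ h0, lt_div_iff₀ h0]
      exact_mod_cast hx
    · rintro ⟨h1, h2⟩
      have hy : 0 ≤ y := le_trans (by positivity) h1
      lift y to ℝ≥0 using hy
      refine ⟨y, ?_, rfl⟩
      rw [Nat.floor_eq_iff (by positivity)]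
      rw [div_le_iff₀ h0] at h1
      rw [lt_div_iff₀ h0] at h2
      exact ⟨by exact_mod_cast h1, by exact_mod_cast h2⟩
  have h2 : vol (cell n q) = volume (((↑) : ℝ≥0 → ℝ) '' (cell n q)) :=
    emb.comap_apply _ _
  rw [h2, h1, Real.volume_Ico, ← sub_div, add_sub_cancel_left, one_div,
    ENNReal.ofReal_inv_of_pos h0, ENNReal.ofReal_natCast]

lemma volume_univ : vol (Set.univ : Set ℝ≥0) = ∞ := by
  have h2 : vol (Set.univ : Set ℝ≥0) = volume (((↑) : ℝ≥0 → ℝ) '' Set.univ) :=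
    emb.comap_apply _ _
  rw [h2, Set.image_univ]
  have : Set.range ((↑) : ℝ≥0 → ℝ) = Set.Ici 0 := Subtype.range_coe
  rw [this, Real.volume_Ici]

lemma p_mono_eq {m n : ℕ} (h : m ≤ n) {x y : ℝ≥0} (hxy : p n x = p n y) : p m x = p m y := by
  induction n, h using Nat.le_induction with
  | base => exact hxy
  | succ n h ih => exact ih (by rw [← p_succ_div n, ← p_succ_div n, hxy])

/-- the algebra of sets determined at a finite stage -/
def Alg : Set (Set ℝ≥0) := {s | ∃ (n : ℕ) (K : Set ℕ), s = p n ⁻¹' K}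

lemma preimage_lift {m n : ℕ} (h : m ≤ n) (K : Set ℕ) : ∃ K', p m ⁻¹' K = p n ⁻¹' K' := by
  refine ⟨p n '' (p m ⁻¹' K), ?_⟩
  ext x
  constructor
  · intro hx
    exact ⟨x, hx, rfl⟩
  · rintro ⟨y, hy, hyx⟩
    have := p_mono_eq h hyx
    simp only [Set.mem_preimage] at *
    rwa [← this]

lemma isSetAlgebra_Alg : IsSetAlgebra Alg where
  empty_mem := ⟨0, ∅, by simp⟩
  compl_mem := by
    rintro s ⟨n, K, rfl⟩
    exact ⟨n, Kᶜ, by simp⟩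
  union_mem := by
    rintro s t ⟨n, K, rfl⟩ ⟨m, K', rfl⟩
    obtain ⟨K1, h1⟩ := preimage_lift (le_max_left n m) K
    obtain ⟨K2, h2⟩ := preimage_lift (le_max_right n m) K'
    exact ⟨max n m, K1 ∪ K2, by rw [h1, h2, Set.preimage_union]⟩

/-- all cells -/
def Cells : Set (Set ℝ≥0) := {s | ∃ n q, s = cell n q}

lemma gen_cells : (inferInstance : MeasurableSpace ℝ≥0) = MeasurableSpace.generateFrom Cells := by
  apply le_antisymm
  · have h1 : ∀ n, @Measurable _ _ (MeasurableSpace.generateFrom Cells) _ (p n) := by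
      intro n
      refine @measurable_to_countable' _ _ _ _ (MeasurableSpace.generateFrom Cells) _ ?_
      intro q
      exact MeasurableSpace.measurableSet_generateFrom ⟨n, q, rfl⟩
    have h2 : @Measurable _ _ (MeasurableSpace.generateFrom Cells) _ (fun x : ℝ≥0 => x) := by
      refine @measurable_of_tendsto_metrizable _ _ (MeasurableSpace.generateFrom Cells) _ _ _ _
        (fun n x => (p n x : ℝ≥0) / R n) _ ?_ ?_
      · intro n
        exact (measurable_from_top (f := fun k : ℕ => (k : ℝ≥0) / R n)).comp (h1 n)
      · rw [tendsto_pi_nhds]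
        exact tendsto_p
    intro s hs
    exact h2 hs
  · apply MeasurableSpace.generateFrom_le
    rintro s ⟨n, q, rfl⟩
    exact measurableSet_cell n q

lemma isPiSystem_cells : IsPiSystem Cells := by
  rintro s ⟨n, q, rfl⟩ t ⟨m, q', rfl⟩ ⟨x, hx1, hx2⟩
  simp only [cell, Set.mem_ofPred_eq] at hx1 hx2
  subst hx1 hx2
  rcases le_total n m with h | h
  · refine ⟨m, p m x, ?_⟩
    ext y
    simp only [cell, Set.mem_inter_iff, Set.mem_ofPred_eq]
    exact ⟨fun h => h.2, fun h' => ⟨p_mono_eq h h', h'⟩⟩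
  · refine ⟨n, p n x, ?_⟩
    ext y
    simp only [cell, Set.mem_inter_iff, Set.mem_ofPred_eq]
    exact ⟨fun h => h.1, fun h' => ⟨h', p_mono_eq h h'⟩⟩

lemma cell_split (n q : ℕ) :
    cell n q = ⋃ j ∈ Finset.range (n + 2), cell (n + 1) ((n + 2) * q + j) := by
  ext x
  simp only [cell, Set.mem_ofPred_eq, Set.mem_iUnion, Finset.mem_range, exists_prop]
  constructor
  · rintro rfl
    exact ⟨_, Nat.mod_lt _ (by omega), p_eq n x⟩
  · rintro ⟨j, hj, h⟩
    rw [← p_succ_div n, h, Nat.mul_add_div (by omega), Nat.div_eq_of_lt hj, add_zero]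

lemma measure_cell_split (ν : Measure ℝ≥0) (n q : ℕ) :
    ν (cell n q) = ∑ j ∈ Finset.range (n + 2), ν (cell (n + 1) ((n + 2) * q + j)) := by
  conv_lhs => rw [cell_split]
  apply measure_biUnion_finset
  · intro i hi j hj hij
    rw [Function.onFun, Set.disjoint_left]
    intro x hx hx'
    simp only [cell, Set.mem_ofPred_eq] at hx hx'
    omega
  · intro j _
    exact measurableSet_cell _ _

lemma iUnion_cell (n : ℕ) : ⋃ q, cell n q = Set.univ := by
  ext x
  simp [cell]

lemma ext_of_cells {ν₁ ν₂ : Measure ℝ≥0} (hfin : ∀ q, ν₁ (cell 0 q) ≠ ∞)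
    (h : ∀ n q, ν₁ (cell n q) = ν₂ (cell n q)) : ν₁ = ν₂ := by
  refine Measure.ext_of_generateFrom_of_iUnion Cells (fun q => cell 0 q) gen_cells
    isPiSystem_cells (iUnion_cell 0) (fun q => ⟨0, q, rfl⟩) hfin ?_
  rintro s ⟨n, q, rfl⟩
  exact h n q

lemma gen_alg : (inferInstance : MeasurableSpace ℝ≥0) = MeasurableSpace.generateFrom Alg := by
  apply le_antisymm
  · rw [gen_cells]
    apply MeasurableSpace.generateFrom_mono
    rintro s ⟨n, q, rfl⟩
    exact ⟨n, {q}, rfl⟩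
  · apply MeasurableSpace.generateFrom_le
    rintro s ⟨n, q, rfl⟩
    exact measurable_p n (MeasurableSet.of_discrete)

instance : SigmaFinite vol :=
  ⟨⟨⟨fun q => cell 0 q, fun _ => trivial, fun q => by rw [volume_cell]; simp [R], iUnion_cell 0⟩⟩⟩

lemma measureDense_alg : vol.MeasureDense Alg := by
  refine Measure.MeasureDense.of_generateFrom_isSetAlgebra_sigmaFinite isSetAlgebra_Alg
    ⟨fun q => cell 0 q, fun q => ⟨0, {q}, rfl⟩, fun q => ?_, iUnion_cell 0⟩ gen_alg
  rw [volume_cell]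
  simp [R]

/-- points in the last column of the cutting of stage `n` -/
def J (n : ℕ) : Set ℝ≥0 := {x | p (n + 1) x % (n + 2) = n + 1}

lemma measurableSet_J (n : ℕ) : MeasurableSet (J n) :=
  measurable_p (n + 1) (t := {k | k % (n + 2) = n + 1}) (MeasurableSet.of_discrete)

lemma volume_cell_J_aux (n q : ℕ) :
    (n + 2 : ℝ≥0∞) * vol (cell n q ∩ J n) = vol (cell n q) := by
  have : cell n q ∩ J n = cell (n + 1) ((n + 2) * q + (n + 1)) := by
    ext x
    simp only [cell, J, Set.mem_inter_iff, Set.mem_ofPred_eq]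
    constructor
    · rintro ⟨h1, h2⟩
      rw [p_eq n x, h1, h2]
    · intro h
      rw [← p_succ_div n, h]
      constructor
      · rw [Nat.mul_add_div (by omega), Nat.div_eq_of_lt (by omega), add_zero]
      · rw [Nat.mul_add_mod, Nat.mod_eq_of_lt (by omega)]
  rw [this, volume_cell, volume_cell, R_succ]
  push_cast
  rw [ENNReal.mul_inv (by simp) (by simp), ← mul_assoc, ENNReal.mul_inv_cancel (by simp)
    (by finiteness), one_mul]

lemma volume_cell_J (d m q : ℕ) :
    (((m + d : ℕ) : ℝ≥0∞) + 2) * vol (cell m q ∩ J (m + d)) = vol (cell m q) := by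
  induction d generalizing m q with
  | zero => exact volume_cell_J_aux m q
  | succ d ih =>
    have h1 := measure_cell_split (vol.restrict (J (m + (d + 1)))) m q
    simp only [Measure.restrict_apply (measurableSet_cell _ _)] at h1
    rw [h1, measure_cell_split vol m q, Finset.mul_sum]
    apply Finset.sum_congr rfl
    intro j _
    rw [← ih (m + 1), show m + 1 + d = m + (d + 1) by ring]

lemma volume_J {m n : ℕ} (h : m ≤ n) (K : Set ℕ) :
    ((n : ℝ≥0∞) + 2) * vol (p m ⁻¹' K ∩ J n) = vol (p m ⁻¹' K) := by
  obtain ⟨d, rfl⟩ := Nat.exists_eq_add_of_le h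
  have key : (((m + d : ℕ) : ℝ≥0∞) + 2) • (vol.restrict (J (m + d))).map (p m)
      = vol.map (p m) := by
    apply Measure.ext_of_singleton
    intro q
    rw [Measure.smul_apply, Measure.map_apply (measurable_p m) (measurableSet_singleton q),
      Measure.map_apply (measurable_p m) (measurableSet_singleton q), Measure.restrict_apply
      (measurable_p m (measurableSet_singleton q))]
    exact volume_cell_J d m q
  have := congrArg (fun ν => ν K) key
  simpa only [Measure.smul_apply, Measure.map_apply (measurable_p m) (MeasurableSet.of_discrete (s := K)),
      Measure.restrict_apply (measurable_p m (MeasurableSet.of_discrete (s := K))), smul_eq_mul] using this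

/-- cutting and stacking data -/
structure Data where
  h : ℕ → ℕ
  e : ℕ → ℕ
  τ : ℕ → Equiv.Perm ℕ
  hτ : ∀ n k, k < h n ↔ τ n k < h n
  hrec : ∀ n k j, k < h n → j < n + 2 → τ (n + 1) (1 + k + j * e n) = (n + 2) * τ n k + j
  he : ∀ n, h n + 2 ≤ e n
  hh : ∀ n, (n + 2) * e n ≤ h (n + 1)
  big : ∀ n, 2 ^ n * R n ≤ h n

namespace Data

variable (D : Data)

/-- height of `x` in tower `n` -/
noncomputable def L (n : ℕ) (x : ℝ≥0) : ℕ := (D.τ n).symm (p n x)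

lemma τ_L (n : ℕ) (x : ℝ≥0) : D.τ n (D.L n x) = p n x := by simp [L]

lemma L_eq_iff (n k : ℕ) (x : ℝ≥0) : D.L n x = k ↔ p n x = D.τ n k := by
  rw [L, Equiv.symm_apply_eq]

lemma L_lt_iff (n : ℕ) (x : ℝ≥0) : D.L n x < D.h n ↔ p n x < D.h n := by
  rw [D.hτ, τ_L]

lemma L_succ {n : ℕ} {x : ℝ≥0} (hx : D.L n x < D.h n) :
    D.L (n + 1) x = 1 + D.L n x + (p (n + 1) x % (n + 2)) * D.e n := by
  rw [L_eq_iff, D.hrec n _ _ hx (Nat.mod_lt _ (by omega)), τ_L, ← p_eq]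

lemma L_of_succ {n k j : ℕ} {x : ℝ≥0} (hk : k < D.h n) (hj : j < n + 2)
    (hx : D.L (n + 1) x = 1 + k + j * D.e n) : D.L n x = k := by
  rw [L_eq_iff, D.hrec n _ _ hk hj] at hx
  rw [L_eq_iff, ← p_succ_div n, hx, Nat.mul_add_div (by omega), Nat.div_eq_of_lt hj, add_zero]

lemma bound {n k j : ℕ} (hk : k < D.h n) (hj : j < n + 2) :
    1 + k + j * D.e n + 1 < D.h (n + 1) := by
  have h1 := D.he n
  have h2 := D.hh n
  have h3 : j * D.e n + D.e n ≤ (n + 2) * D.e n := by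
    rw [← Nat.succ_mul]
    exact Nat.mul_le_mul_right _ hj
  omega

lemma L_succ_lt {n : ℕ} {x : ℝ≥0} (hx : D.L n x < D.h n) :
    D.L (n + 1) x + 1 < D.h (n + 1) := by
  rw [D.L_succ hx]
  exact D.bound hx (Nat.mod_lt _ (by omega))

lemma L_succ_pos {n : ℕ} {x : ℝ≥0} (hx : D.L n x < D.h n) :
    1 ≤ D.L (n + 1) x := by
  rw [D.L_succ hx]
  omega

lemma L_lt_mono {m n : ℕ} (hmn : m ≤ n) {x : ℝ≥0} (hx : D.L m x < D.h m) :
    D.L n x < D.h n := by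
  induction n, hmn using Nat.le_induction with
  | base => exact hx
  | succ n _ ih =>
    have := D.L_succ_lt ih
    omega

lemma exists_L_lt (x : ℝ≥0) : ∃ n, D.L n x < D.h n := by
  obtain ⟨n, hn⟩ := pow_unbounded_of_one_lt x (one_lt_two)
  refine ⟨n, ?_⟩
  rw [L_lt_iff]
  refine lt_of_lt_of_le ?_ (D.big n)
  have h1 := p_le n x
  have h2 : x * R n < 2 ^ n * R n := by
    have : (0 : ℝ≥0) < R n := by exact_mod_cast R_pos n
    gcongr
  exact_mod_cast h1.trans_lt h2

lemma exists_good (x : ℝ≥0) : ∃ n, D.L n x + 1 < D.h n := by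
  obtain ⟨n, hn⟩ := D.exists_L_lt x
  exact ⟨n + 1, D.L_succ_lt hn⟩

/-- candidate for the transformation at stage `n` -/
noncomputable def F (n : ℕ) (x : ℝ≥0) : ℝ≥0 := mv n (D.τ n (D.L n x + 1)) x

lemma F_succ {n : ℕ} {x : ℝ≥0} (hx : D.L n x + 1 < D.h n) : D.F (n + 1) x = D.F n x := by
  unfold F
  rw [D.L_succ (by omega), show 1 + D.L n x + (p (n + 1) x % (n + 2)) * D.e n + 1
    = 1 + (D.L n x + 1) + (p (n + 1) x % (n + 2)) * D.e n by ring,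
    D.hrec n _ _ hx (Nat.mod_lt _ (by omega)), mv_succ]

lemma F_mono {m n : ℕ} (hmn : m ≤ n) {x : ℝ≥0} (hx : D.L m x + 1 < D.h m) :
    D.F n x = D.F m x ∧ D.L n x + 1 < D.h n := by
  induction n, hmn using Nat.le_induction with
  | base => exact ⟨rfl, hx⟩
  | succ n _ ih => exact ⟨(D.F_succ ih.2).trans ih.1, D.L_succ_lt (by omega)⟩

/-- the rank one map -/
noncomputable def S (x : ℝ≥0) : ℝ≥0 := D.F (Nat.find (D.exists_good x)) x

lemma S_eq {n : ℕ} {x : ℝ≥0} (hx : D.L n x + 1 < D.h n) : D.S x = D.F n x :=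
  ((D.F_mono (Nat.find_min' (D.exists_good x) hx) (Nat.find_spec (D.exists_good x))).1).symm

lemma L_mv (n k : ℕ) (x : ℝ≥0) : D.L n (mv n (D.τ n k) x) = k := by
  rw [L_eq_iff, p_mv]

lemma L_S {n : ℕ} {x : ℝ≥0} (hx : D.L n x + 1 < D.h n) : D.L n (D.S x) = D.L n x + 1 := by
  rw [D.S_eq hx, F, L_mv]

lemma S_injective : Function.Injective D.S := by
  intro x y hxy
  obtain ⟨a, ha⟩ := D.exists_good x
  obtain ⟨b, hb⟩ := D.exists_good y
  have ha' := (D.F_mono (le_max_left a b) ha).2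
  have hb' := (D.F_mono (le_max_right a b) hb).2
  generalize max a b = n at *
  have h1 := D.L_S ha'
  have h2 := D.L_S hb'
  have h3 : D.L n x = D.L n y := by
    rw [hxy] at h1
    omega
  have h4 : mv n (p n x) (D.S x) = x := by
    rw [D.S_eq ha', F, mv_mv, mv_self]
  have h5 : mv n (p n y) (D.S y) = y := by
    rw [D.S_eq hb', F, mv_mv, mv_self]
  rw [← h4, ← h5, hxy, ← D.τ_L, ← D.τ_L n y, h3]

lemma S_mv {n k : ℕ} {y : ℝ≥0} (hk : k + 1 < D.h n) (hy : D.L n y = k + 1) :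
    D.S (mv n (D.τ n k) y) = y := by
  rw [D.S_eq (n := n) (by rwa [L_mv]), F, L_mv, mv_mv, ← hy, τ_L, mv_self]

lemma S_surjective : Function.Surjective D.S := by
  intro y
  obtain ⟨a, ha⟩ := D.exists_L_lt y
  have h1 := D.L_succ_lt ha
  have h2 := D.L_succ_pos ha
  obtain ⟨k, hk⟩ := Nat.exists_eq_add_of_le' h2
  exact ⟨_, D.S_mv (by omega) hk⟩

lemma L_S_iff {n k : ℕ} {x : ℝ≥0} (hk : k + 1 < D.h n) : D.L n (D.S x) = k + 1 ↔ D.L n x = k := by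
  constructor
  · intro h
    have := D.S_injective (D.S_mv hk h)
    rw [← this, L_mv]
  · rintro rfl
    exact D.L_S hk

lemma L_iter {n i : ℕ} {x : ℝ≥0} (hx : D.L n x + i < D.h n) :
    D.L n (D.S^[i] x) = D.L n x + i := by
  induction i with
  | zero => rfl
  | succ i ih =>
    have := ih (by omega)
    rw [Function.iterate_succ_apply', D.L_S (by omega)]
    omega

lemma measurable_L (n : ℕ) : Measurable (D.L n) :=
  (measurable_from_top (f := (D.τ n).symm)).comp (measurable_p n)

lemma measurable_F (n : ℕ) : Measurable (D.F n) := by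
  unfold F mv
  have h1 : Measurable fun x => ((D.τ n (D.L n x + 1) : ℕ) : ℝ≥0) :=
    (measurable_from_top (f := fun k : ℕ => ((D.τ n (k + 1) : ℕ) : ℝ≥0))).comp (D.measurable_L n)
  have h2 : Measurable fun x => (p n x : ℝ≥0) :=
    (measurable_from_top (f := fun k : ℕ => (k : ℝ≥0))).comp (measurable_p n)
  fun_prop

lemma measurable_S : Measurable D.S := by
  unfold S
  refine Measurable.find (f := D.F) D.measurable_F (fun n => ?_) D.exists_good
  exact D.measurable_L n (t := {k | k + 1 < D.h n}) MeasurableSet.of_discrete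

lemma L_set (n k : ℕ) : {x | D.L n x = k} = cell n (D.τ n k) := by
  ext x
  exact D.L_eq_iff n k x

lemma ext_of_levels {ν₁ ν₂ : Measure ℝ≥0} (hfin : ∀ q, ν₂ (cell 0 q) ≠ ∞)
    (hL : ∀ n k, k + 1 < D.h n → ν₁ {x | D.L n x = k + 1} = ν₂ {x | D.L n x = k + 1}) :
    ν₁ = ν₂ := by
  symm
  apply ext_of_cells hfin
  have key : ∀ d n q, (∀ x ∈ cell n q, D.L (n + d) x < D.h (n + d)) →
      ν₁ (cell n q) = ν₂ (cell n q) := by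
    intro d
    induction d with
    | zero =>
      intro n q hx
      rw [measure_cell_split, measure_cell_split ν₂]
      refine Finset.sum_congr rfl fun j hj => ?_
      have hj' : j < n + 2 := by simpa using hj
      have h1 : D.L n (mv n q 0) < D.h n := hx _ (by simp [cell, p_mv])
      have h2 : q = D.τ n (D.L n (mv n q 0)) := by rw [τ_L, p_mv]
      generalize D.L n (mv n q 0) = k at *
      have h3 := D.hrec n k j h1 hj'
      have h4 := D.bound h1 hj'
      rw [h2, ← h3, ← L_set, show 1 + k + j * D.e n = (k + j * D.e n) + 1 by ring]
      exact hL _ _ (by omega)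
    | succ d ih =>
      intro n q hx
      rw [measure_cell_split, measure_cell_split ν₂]
      refine Finset.sum_congr rfl fun j hj => ih _ _ fun x hx' => ?_
      rw [show n + 1 + d = n + (d + 1) by ring]
      apply hx
      rw [cell_split]
      exact Set.mem_biUnion hj hx'
  intro n q
  obtain ⟨d, hd⟩ := pow_unbounded_of_one_lt ((q : ℝ≥0) + 1) (one_lt_two)
  refine (key d n q ?_).symm
  intro x hx
  rw [L_lt_iff]
  refine lt_of_lt_of_le ?_ (D.big _)
  have h0 := p_lt n x
  have hx' : p n x = q := hx
  have h1 := p_le (n + d) x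
  have h2 : x * R (n + d) < 2 ^ (n + d) * R (n + d) := by
    have : (0 : ℝ≥0) < R (n + d) := by exact_mod_cast R_pos _
    gcongr
    have h3 : (1 : ℝ≥0) ≤ R n := by exact_mod_cast R_pos n
    calc x = x * 1 := by simp
      _ ≤ x * R n := by gcongr
      _ < p n x + 1 := h0
      _ = q + 1 := by rw [hx']
      _ < 2 ^ d := hd
      _ ≤ 2 ^ (n + d) := by
        gcongr
        · norm_num
        · omega
  exact_mod_cast h1.trans_lt h2

lemma measurePreserving_S : MeasurePreserving D.S vol vol := by
  refine ⟨D.measurable_S, ?_⟩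
  apply D.ext_of_levels
  · intro q
    rw [volume_cell]
    simp [R]
  · intro n k hk
    rw [Measure.map_apply D.measurable_S
      (by rw [L_set]; exact measurableSet_cell _ _)]
    have : D.S ⁻¹' {x | D.L n x = k + 1} = {x | D.L n x = k} := by
      ext x
      exact D.L_S_iff hk
    rw [this, L_set, L_set, volume_cell, volume_cell]

/-- the automorphism -/
noncomputable def E : ℝ≥0 ≃ᵐ ℝ≥0 where
  toEquiv := Equiv.ofBijective D.S ⟨D.S_injective, D.S_surjective⟩
  measurable_toFun := D.measurable_S
  measurable_invFun := by
    have h1 := D.measurable_S.measurableEmbedding D.S_injective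
    intro s hs
    have := h1.measurableSet_image.2 hs
    convert this using 1
    exact (Equiv.image_eq_preimage_symm
      (Equiv.ofBijective D.S ⟨D.S_injective, D.S_surjective⟩) s).symm

lemma coe_E : (⇑D.E : ℝ≥0 → ℝ≥0) = D.S := rfl

lemma ergodic_E : ErgodicAut vol D.E := by
  intro A hA hinv
  rw [coe_E] at hinv
  have hAE : D.S ⁻¹' A =ᵐ[vol] A := by
    rwa [← measure_symmDiff_eq_zero_iff]
  have hstep : ∀ n k, k + 1 < D.h n →
      vol (A ∩ {x | D.L n x = k + 1}) = vol (A ∩ {x | D.L n x = k}) := by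
    intro n k hk
    have hm : MeasurableSet (A ∩ {x | D.L n x = k + 1}) :=
      hA.inter (by rw [L_set]; exact measurableSet_cell _ _)
    rw [← D.measurePreserving_S.measure_preimage hm.nullMeasurableSet, Set.preimage_inter]
    have : D.S ⁻¹' {x | D.L n x = k + 1} = {x | D.L n x = k} := by
      ext x
      exact D.L_S_iff hk
    rw [this]
    exact measure_congr (hAE.inter (ae_eq_refl _))
  have hconst : ∀ n k, k < D.h n →
      vol (A ∩ {x | D.L n x = k}) = vol (A ∩ {x | D.L n x = 0}) := by
    intro n k
    induction k with
    | zero => intro _; rfl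
    | succ k ih =>
      intro hk
      rw [hstep n k hk, ih (by omega)]
  have hpos : ∀ n, 0 < D.h n := fun n =>
    lt_of_lt_of_le (Nat.mul_pos (by positivity) (R_pos n)) (D.big n)
  have hrecA : ∀ n, vol (A ∩ {x | D.L n x = 0}) =
      (n + 2 : ℕ) * vol (A ∩ {x | D.L (n + 1) x = 0}) := by
    intro n
    have h1 := measure_cell_split (vol.restrict A) n (D.τ n 0)
    rw [L_set, Set.inter_comm, ← Measure.restrict_apply (measurableSet_cell _ _), h1]
    rw [Finset.sum_congr rfl (g := fun _ => vol (A ∩ {x | D.L (n + 1) x = 0}))]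
    · simp
    · intro j hj
      have hj' : j < n + 2 := by simpa using hj
      rw [← D.hrec n 0 j (hpos n) hj', Measure.restrict_apply (measurableSet_cell _ _),
        Set.inter_comm, ← L_set]
      apply hconst
      have := D.bound (hpos n) hj'
      omega
  have hval : ∀ n, (R n : ℝ≥0∞) * vol (A ∩ {x | D.L n x = 0}) = vol (A ∩ {x | D.L 0 x = 0}) := by
    intro n
    induction n with
    | zero => simp [R]
    | succ n ih =>
      rw [← ih, hrecA n, R_succ]
      push_cast
      ring
  have hfin : vol (A ∩ {x | D.L 0 x = 0}) ≠ ∞ := by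
    refine ne_top_of_le_ne_top ?_ (measure_mono Set.inter_subset_right)
    rw [L_set, volume_cell]
    simp [R]
  generalize vol (A ∩ {x | D.L 0 x = 0}) = a at *
  have hres : vol.restrict A = a • vol := by
    apply D.ext_of_levels
    · intro q
      rw [Measure.smul_apply, volume_cell]
      simpa [R] using hfin
    · intro n k hk
      rw [Measure.restrict_apply (by rw [L_set]; exact measurableSet_cell _ _), Set.inter_comm,
        hconst n _ hk, Measure.smul_apply, L_set D n (k + 1), volume_cell, ← hval n, smul_eq_mul,
        mul_comm, ← mul_assoc, ENNReal.inv_mul_cancel, one_mul]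
      · exact_mod_cast (R_pos n).ne'
      · simp
  have h1 := congrArg (fun ν => ν Aᶜ) hres
  simp only [Measure.restrict_apply hA.compl, Set.compl_inter_self, measure_empty,
    Measure.smul_apply, smul_eq_mul] at h1
  rcases mul_eq_zero.1 h1.symm with h | h
  · left
    have h2 := congrArg (fun ν => ν A) hres
    simpa [h, Measure.restrict_apply hA] using h2
  · exact Or.inr h

lemma iter_inj (i : ℕ) : Function.Injective (D.S^[i]) := D.S_injective.iterate i

lemma iter_image_meas (i : ℕ) {A : Set ℝ≥0} (hA : MeasurableSet A) :
    MeasurableSet (D.S^[i] '' A) :=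
  ((D.measurable_S.iterate i).measurableEmbedding (D.iter_inj i)).measurableSet_image.2 hA

lemma inter_image (i : ℕ) {A B : Set ℝ≥0} (hA : MeasurableSet A) (hB : MeasurableSet B) :
    vol (D.S^[i] '' A ∩ B) = vol (A ∩ D.S^[i] ⁻¹' B) := by
  rw [← (D.measurePreserving_S.iterate i).measure_preimage
    ((D.iter_image_meas i hA).inter hB).nullMeasurableSet, Set.preimage_inter,
    Set.preimage_image_eq _ (D.iter_inj i)]

lemma symmDiff_image (i : ℕ) {A : Set ℝ≥0} (hA : MeasurableSet A) :
    vol ((D.S^[i] '' A) ∆ A) = vol (A ∆ (D.S^[i] ⁻¹' A)) := by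
  rw [← (D.measurePreserving_S.iterate i).measure_preimage
    ((D.iter_image_meas i hA).symmDiff hA).nullMeasurableSet, Set.preimage_symmDiff,
    Set.preimage_image_eq _ (D.iter_inj i)]

/-- the tower of stage `n` -/
def X (n : ℕ) : Set ℝ≥0 := {x | D.L n x < D.h n}

lemma measurableSet_X (n : ℕ) : MeasurableSet (D.X n) :=
  D.measurable_L n (t := {k | k < D.h n}) MeasurableSet.of_discrete

lemma tail {A : Set ℝ≥0} (hA : MeasurableSet A) (hfin : vol A ≠ ∞) :
    Tendsto (fun n => vol (A \ D.X n)) atTop (𝓝 0) := by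
  have h1 := tendsto_measure_iInter_atTop (μ := vol) (s := fun n => A \ D.X n)
    (fun n => (hA.diff (D.measurableSet_X n)).nullMeasurableSet)
    (fun m n hmn x hx => ⟨hx.1, fun h => hx.2 (D.L_lt_mono hmn h)⟩)
    ⟨0, ne_top_of_le_ne_top hfin (measure_mono Set.sdiff_subset)⟩
  have h2 : ⋂ n, A \ D.X n = ∅ := by
    rw [Set.eq_empty_iff_forall_notMem]
    intro x hx
    obtain ⟨n, hn⟩ := D.exists_L_lt x
    exact (Set.mem_iInter.1 hx n).2 hn
  rwa [h2, measure_empty] at h1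

lemma zeroType (f : ℕ → ℕ)
    (hf : ∀ n k j, k < D.h n → j < n + 2 → 1 + k + j * D.e n + f n < D.h (n + 1) ∧
      ∀ k' j', k' < D.h n → j' < n + 2 → 1 + k + j * D.e n + f n ≠ 1 + k' + j' * D.e n)
    {A B : Set ℝ≥0} (hA : MeasurableSet A) (hB : MeasurableSet B) (hA' : vol A ≠ ∞)
    (hB' : vol B ≠ ∞) :
    Tendsto (fun n => vol (D.S^[f n] '' A ∩ B)) atTop (𝓝 0) := by
  have h1 := (D.tail hA hA').add (D.tail hB hB')
  rw [add_zero] at h1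
  refine tendsto_of_tendsto_of_tendsto_of_le_of_le tendsto_const_nhds h1 (fun _ => zero_le) ?_
  intro n
  dsimp only
  rw [inter_image _ _ hA hB]
  have hsub : A ∩ D.S^[f n] ⁻¹' B ⊆ (A \ D.X n) ∪ D.S^[f n] ⁻¹' (B \ D.X n) := by
    rintro x ⟨hx1, hx2⟩
    by_cases hx : x ∈ D.X n
    · right
      refine ⟨hx2, fun hy => ?_⟩
      have a1 := D.L_succ hx
      have a2 := D.L_succ hy
      have a3 := hf n _ _ hx (Nat.mod_lt (p (n + 1) x) (show n + 2 > 0 by omega))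
      have a4 := a3.2 _ _ hy (Nat.mod_lt (p (n + 1) (D.S^[f n] x)) (show n + 2 > 0 by omega))
      rw [← a1] at a3 a4
      rw [← a2, D.L_iter a3.1] at a4
      exact a4 rfl
    · exact Or.inl ⟨hx1, hx⟩
  refine (measure_mono hsub).trans ((measure_union_le _ _).trans ?_)
  rw [(D.measurePreserving_S.iterate _).measure_preimage
    (hB.diff (D.measurableSet_X n)).nullMeasurableSet]

lemma diff_eq (i : ℕ) {A : Set ℝ≥0} (hA : MeasurableSet A) (hfin : vol A ≠ ∞) :
    vol (D.S^[i] ⁻¹' A \ A) = vol (A \ D.S^[i] ⁻¹' A) := by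
  have hm : MeasurableSet (D.S^[i] ⁻¹' A) := D.measurable_S.iterate i hA
  have h1 := measure_inter_add_sdiff (μ := vol) A hm
  have h2 := measure_inter_add_sdiff (μ := vol) (D.S^[i] ⁻¹' A) hA
  rw [(D.measurePreserving_S.iterate _).measure_preimage hA.nullMeasurableSet, ← h1,
    Set.inter_comm] at h2
  exact (ENNReal.add_right_inj
    (ne_top_of_le_ne_top hfin (measure_mono Set.inter_subset_left))).1 h2

lemma e_return {n : ℕ} {x : ℝ≥0} (hx : x ∈ D.X n) (hJ : x ∉ J n) :
    p n (D.S^[D.e n] x) = p n x := by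
  have hlt : p (n + 1) x % (n + 2) < n + 2 := Nat.mod_lt _ (by omega)
  have hJ' : p (n + 1) x % (n + 2) ≠ n + 1 := hJ
  have h1 := D.L_succ hx
  generalize p (n + 1) x % (n + 2) = j at *
  have h2 : 1 + D.L n x + j * D.e n + D.e n = 1 + D.L n x + (j + 1) * D.e n := by ring
  have h3 := D.bound hx (show j + 1 < n + 2 by omega)
  have h4 := D.L_iter (n := n + 1) (i := D.e n) (x := x) (by rw [h1, h2]; omega)
  rw [h1, h2] at h4
  have h5 := D.L_of_succ hx (by omega) h4
  rw [← D.τ_L, h5, τ_L]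

lemma rigid_alg (m : ℕ) (K : Set ℕ) (hfin : vol (p m ⁻¹' K) ≠ ∞) :
    Tendsto (fun n => vol ((p m ⁻¹' K) ∆ (D.S^[D.e n] ⁻¹' (p m ⁻¹' K)))) atTop (𝓝 0) := by
  have hA : MeasurableSet (p m ⁻¹' K) := measurable_p m MeasurableSet.of_discrete
  have h1 := D.tail hA hfin
  have h2 : Tendsto (fun n : ℕ => vol (p m ⁻¹' K) * ((n + 2 : ℕ) : ℝ≥0∞)⁻¹) atTop (𝓝 0) := by
    have := ENNReal.tendsto_inv_nat_nhds_zero.comp (tendsto_add_atTop_nat 2)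
    have := ENNReal.Tendsto.const_mul this (Or.inr hfin) (a := vol (p m ⁻¹' K))
    simpa using this
  have h3 := (h1.add h2).add (h1.add h2)
  simp only [add_zero] at h3
  refine tendsto_of_tendsto_of_tendsto_of_le_of_le' tendsto_const_nhds h3
    (Eventually.of_forall fun _ => zero_le) ?_
  filter_upwards [eventually_ge_atTop m] with n hn
  have hle : vol (p m ⁻¹' K \ D.S^[D.e n] ⁻¹' (p m ⁻¹' K)) ≤
      vol (p m ⁻¹' K \ D.X n) + vol (p m ⁻¹' K) * ((n + 2 : ℕ) : ℝ≥0∞)⁻¹ := by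
    have hs : p m ⁻¹' K \ D.S^[D.e n] ⁻¹' (p m ⁻¹' K) ⊆
        (p m ⁻¹' K \ D.X n) ∪ (p m ⁻¹' K ∩ J n) := by
      rintro x ⟨hx1, hx2⟩
      by_cases hx : x ∈ D.X n
      · right
        refine ⟨hx1, ?_⟩
        by_contra hJ
        apply hx2
        have := p_mono_eq hn (D.e_return hx hJ)
        simp only [Set.mem_preimage] at *
        rwa [this]
      · exact Or.inl ⟨hx1, hx⟩
    refine (measure_mono hs).trans ((measure_union_le _ _).trans ?_)
    gcongr
    rw [← volume_J hn K, mul_comm, ← mul_assoc]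
    push_cast
    rw [ENNReal.inv_mul_cancel (by simp) (by finiteness), one_mul]
  rw [measure_symmDiff_eq hA.nullMeasurableSet
    (D.measurable_S.iterate _ hA).nullMeasurableSet, D.diff_eq _ hA hfin]
  gcongr

lemma rigid {A : Set ℝ≥0} (hA : MeasurableSet A) (hfin : vol A ≠ ∞) :
    Tendsto (fun n => vol ((D.S^[D.e n] '' A) ∆ A)) atTop (𝓝 0) := by
  simp only [D.symmDiff_image _ hA]
  rw [ENNReal.tendsto_nhds_zero]
  intro ε hε
  obtain ⟨δ, hδ, hδε⟩ : ∃ δ : ℝ, 0 < δ ∧ ENNReal.ofReal δ + ENNReal.ofReal δ +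
      ENNReal.ofReal δ ≤ ε := by
    rcases eq_or_ne ε ∞ with rfl | hne
    · exact ⟨1, one_pos, le_top⟩
    · have hp := ENNReal.toReal_pos hε.ne' hne
      refine ⟨ε.toReal / 3, by positivity, ?_⟩
      rw [← ENNReal.ofReal_add (by positivity) (by positivity),
        ← ENNReal.ofReal_add (by positivity) (by positivity)]
      rw [show ε.toReal / 3 + ε.toReal / 3 + ε.toReal / 3 = ε.toReal by ring,
        ENNReal.ofReal_toReal hne]
  obtain ⟨t, ⟨m, K, rfl⟩, ht⟩ := measureDense_alg.approx A hA hfin δ hδ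
  have htm : MeasurableSet (p m ⁻¹' K) := measurable_p m MeasurableSet.of_discrete
  have htfin : vol (p m ⁻¹' K) ≠ ∞ := by
    have : vol (p m ⁻¹' K) ≤ vol A + vol (A ∆ (p m ⁻¹' K)) := by
      refine (measure_mono ?_).trans (measure_union_le _ _)
      intro x hx
      by_cases h : x ∈ A
      · exact Or.inl h
      · exact Or.inr (Or.inr ⟨hx, h⟩)
    refine ne_top_of_le_ne_top ?_ this
    exact ENNReal.add_ne_top.2 ⟨hfin, (ht.trans ENNReal.ofReal_lt_top).ne⟩
  have h1 := (ENNReal.tendsto_nhds_zero.1 (D.rigid_alg m K htfin)) (ENNReal.ofReal δ) (by simpa)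
  filter_upwards [h1] with n hn
  refine le_trans ?_ hδε
  generalize p m ⁻¹' K = t at *
  have h2 : vol ((D.S^[D.e n] ⁻¹' t) ∆ (D.S^[D.e n] ⁻¹' A)) = vol (A ∆ t) := by
    rw [← Set.preimage_symmDiff, (D.measurePreserving_S.iterate _).measure_preimage
      (htm.symmDiff hA).nullMeasurableSet, symmDiff_comm]
  calc vol (A ∆ (D.S^[D.e n] ⁻¹' A))
      ≤ vol (A ∆ t) + vol (t ∆ (D.S^[D.e n] ⁻¹' A)) := measure_symmDiff_le _ _ _
    _ ≤ vol (A ∆ t) + (vol (t ∆ (D.S^[D.e n] ⁻¹' t)) +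
        vol ((D.S^[D.e n] ⁻¹' t) ∆ (D.S^[D.e n] ⁻¹' A))) := by
        gcongr
        exact measure_symmDiff_le _ _ _
    _ ≤ ENNReal.ofReal δ + (ENNReal.ofReal δ + ENNReal.ofReal δ) := by
        rw [h2]
        gcongr
    _ = _ := by ring

end Data

lemma exists_perm (n h e h' : ℕ) (τ : Equiv.Perm ℕ) (hτ : ∀ k, k < h ↔ τ k < h)
    (he : h + 2 ≤ e) (hh : (n + 2) * e ≤ h') :
    ∃ τ' : Equiv.Perm ℕ, (∀ k, k < h' ↔ τ' k < h') ∧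
      ∀ k j, k < h → j < n + 2 → τ' (1 + k + j * e) = (n + 2) * τ k + j := by
  classical
  have hpos : 0 < e := by omega
  -- heights decompose uniquely
  have hdm : ∀ k j, k < h → (1 + k + j * e) / e = j ∧ (1 + k + j * e) % e = 1 + k := by
    intro k j hk
    rw [Nat.add_mul_div_right _ _ hpos, Nat.add_mul_mod_self_right,
      Nat.div_eq_of_lt (by omega), Nat.mod_eq_of_lt (by omega)]
    simp
  let f : Fin h' → ℕ := fun i => (n + 2) * τ ((i : ℕ) % e - 1) + (i : ℕ) / e
  let s : Finset (Fin h') := Finset.univ.filter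
    (fun i => ∃ k j, k < h ∧ j < n + 2 ∧ (i : ℕ) = 1 + k + j * e)
  have hf : ∀ (i : Fin h') k j, k < h → j < n + 2 → (i : ℕ) = 1 + k + j * e →
      f i = (n + 2) * τ k + j := by
    intro i k j hk hj hi
    obtain ⟨h1, h2⟩ := hdm k j hk
    simp only [f, hi, h1, h2]
    simp
  have himg : Finset.image f s ⊆ Finset.range h' := by
    intro y hy
    simp only [Finset.mem_image, s, Finset.mem_filter, Finset.mem_univ, true_and] at hy
    obtain ⟨i, ⟨k, j, hk, hj, hi⟩, rfl⟩ := hy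
    rw [hf i k j hk hj hi, Finset.mem_range]
    have h1 := (hτ k).1 hk
    have h2 : (n + 2) * (τ k + 1) ≤ (n + 2) * e := Nat.mul_le_mul_left _ (by omega)
    rw [Nat.mul_add] at h2
    omega
  have hinj : Set.InjOn f s := by
    intro i hi i' hi' hii
    simp only [s, Finset.coe_filter, Finset.mem_univ, true_and, Set.mem_ofPred_eq] at hi hi'
    obtain ⟨k, j, hk, hj, hi⟩ := hi
    obtain ⟨k', j', hk', hj', hi'⟩ := hi'
    rw [hf i k j hk hj hi, hf i' k' j' hk' hj' hi'] at hii
    have h1 : j = j' := by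
      have := congrArg (· % (n + 2)) hii
      simpa [Nat.mul_add_mod, Nat.mod_eq_of_lt hj, Nat.mod_eq_of_lt hj'] using this
    subst h1
    have h2 : τ k = τ k' := Nat.eq_of_mul_eq_mul_left (show 0 < n + 2 by omega) (by omega)
    have h3 := τ.injective h2
    subst h3
    exact Fin.ext (hi.trans hi'.symm)
  obtain ⟨g, hg⟩ := Finset.exists_equiv_extend_of_card_eq (t := Finset.range h') (by simp)
    himg hinj
  let g' : Equiv.Perm {k : ℕ // k < h'} :=
    Fin.equivSubtype.symm.trans (g.trans (Equiv.subtypeEquivRight (by simp)))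
  refine ⟨Equiv.Perm.ofSubtype g', ?_, ?_⟩
  · intro k
    constructor
    · intro hk
      rw [Equiv.Perm.ofSubtype_apply_of_mem g' hk]
      exact (g' ⟨k, hk⟩).2
    · intro hk
      by_contra hk'
      rw [Equiv.Perm.ofSubtype_apply_of_not_mem g' hk'] at hk
      exact hk' hk
  · intro k j hk hj
    have hlt : 1 + k + j * e < h' := by
      have : j * e + e ≤ (n + 2) * e := by
        rw [← Nat.succ_mul]
        exact Nat.mul_le_mul_right _ hj
      omega
    rw [Equiv.Perm.ofSubtype_apply_of_mem g' hlt]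
    have h1 := hg ⟨1 + k + j * e, hlt⟩ (by
      simp only [s, Finset.mem_filter, Finset.mem_univ, true_and]
      exact ⟨k, j, hk, hj, rfl⟩)
    rw [hf _ k j hk hj rfl] at h1
    rw [← h1]
    rfl

lemma exists_data (h e : ℕ → ℕ) (he : ∀ n, h n + 2 ≤ e n) (hh : ∀ n, (n + 2) * e n ≤ h (n + 1))
    (big : ∀ n, 2 ^ n * R n ≤ h n) : ∃ D : Data, D.h = h ∧ D.e = e := by
  let T (n : ℕ) := {τ : Equiv.Perm ℕ // ∀ k, k < h n ↔ τ k < h n}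
  let step (n : ℕ) (t : T n) : T (n + 1) :=
    ⟨(exists_perm n (h n) (e n) (h (n + 1)) t.1 t.2 (he n) (hh n)).choose,
     (exists_perm n (h n) (e n) (h (n + 1)) t.1 t.2 (he n) (hh n)).choose_spec.1⟩
  let τ (n : ℕ) : T n := Nat.rec (motive := T) ⟨1, fun _ => Iff.rfl⟩ step n
  refine ⟨⟨h, e, fun n => (τ n).1, fun n => (τ n).2, ?_, he, hh, big⟩, rfl, rfl⟩
  intro n
  exact (exists_perm n (h n) (e n) (h (n + 1)) (τ n).1 (τ n).2 (he n) (hh n)).choose_spec.2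

lemma exists_seq (C' D' : Set ℕ) (hC' : C'.Infinite) (hD' : D'.Infinite) :
    ∃ h c d : ℕ → ℕ, (∀ n, c n ∈ C') ∧ (∀ n, d n ∈ D') ∧ (∀ n, h n + 2 ≤ c n) ∧
      (∀ n, (n + 2) * c n ≤ d n) ∧ (∀ n, h (n + 1) = (n + 2) * d n) ∧ h 0 = 1 := by
  choose c hc1 hc2 using fun k => hC'.exists_gt k
  choose d hd1 hd2 using fun k => hD'.exists_gt k
  let h (n : ℕ) : ℕ := Nat.rec (motive := fun _ => ℕ) 1
    (fun n k => (n + 2) * d ((n + 2) * c (k + 2))) n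
  exact ⟨h, fun n => c (h n + 2), fun n => d ((n + 2) * c (h n + 2)), fun n => hc1 _,
    fun n => hd1 _, fun n => (hc2 _).le, fun n => (hd2 _).le, fun n => rfl, rfl⟩

lemma eps_of_tendsto {c : ℕ → ℕ} (hc : StrictMono c) {u v : ℕ → ℝ≥0∞}
    (hu : Tendsto (fun n => u (c n)) atTop (𝓝 0)) (hv : Tendsto (fun n => v (c n)) atTop (𝓝 0))
    (ε : ℝ≥0∞) (hε : 0 < ε) :
    ∃ N : ℕ, ∀ i ∈ Set.range c, N ≤ i → u i < ε ∧ v i < ε := by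
  obtain ⟨n, hn⟩ := eventually_atTop.1
    ((hu.eventually_lt_const hε).and (hv.eventually_lt_const hε))
  refine ⟨c n, ?_⟩
  rintro _ ⟨m, rfl⟩ hm
  exact hn m (hc.le_iff_le.1 hm)

end RankOne

/-- For any infinite `C', D' ⊆ ℕ` there are infinite subsets `C ⊆ C'`, `D ⊆ D'`,
a σ-finite infinite measure space `(X, μ)`, and ergodic automorphisms `S̄, T̄` such that
for all measurable `A, B` of finite measure: `μ(S̄ⁱ(A) ∩ B) → 0` and `μ(T̄ⁱ(A) ∆ A) → 0`
along `i ∈ C`, while `μ(S̄ⁱ(A) ∆ A) → 0` and `μ(T̄ⁱ(A) ∩ B) → 0` along `i ∈ D`. -/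
theorem statement11 (C' D' : Set ℕ) (hC' : C'.Infinite) (hD' : D'.Infinite) :
    ∃ (C D : Set ℕ), C ⊆ C' ∧ D ⊆ D' ∧ C.Infinite ∧ D.Infinite ∧
    ∃ (X : Type) (_ : MeasurableSpace X) (μ : Measure X) (_ : SigmaFinite μ),
      μ Set.univ = ∞ ∧
      ∃ S T : X ≃ᵐ X,
        MeasurePreserving (⇑S) μ μ ∧ MeasurePreserving (⇑T) μ μ ∧
        ErgodicAut μ S ∧ ErgodicAut μ T ∧
        ∀ A B : Set X, MeasurableSet A → MeasurableSet B → μ A < ∞ → μ B < ∞ →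
          (∀ ε : ℝ≥0∞, 0 < ε → ∃ N : ℕ, ∀ i ∈ C, N ≤ i →
            μ ((⇑S)^[i] '' A ∩ B) < ε ∧ μ (((⇑T)^[i] '' A) ∆ A) < ε) ∧
          (∀ ε : ℝ≥0∞, 0 < ε → ∃ N : ℕ, ∀ i ∈ D, N ≤ i →
            μ (((⇑S)^[i] '' A) ∆ A) < ε ∧ μ ((⇑T)^[i] '' A ∩ B) < ε) := by
  classical
  obtain ⟨h, c, d, hcC, hdD, hc, hd, hh, h0⟩ := RankOne.exists_seq C' D' hC' hD'
  have hd2 : ∀ n, 2 * c n ≤ d n := fun n =>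
    le_trans (Nat.mul_le_mul_right _ (by omega)) (hd n)
  have hh2 : ∀ n, 2 * d n ≤ h (n + 1) := fun n => by
    rw [hh]
    exact Nat.mul_le_mul_right _ (by omega)
  have big : ∀ n, 2 ^ n * RankOne.R n ≤ h n := by
    intro n
    induction n with
    | zero => simp [RankOne.R, h0]
    | succ n ih =>
      rw [hh, RankOne.R_succ]
      have h1 := hd2 n
      have h2 := hc n
      calc 2 ^ (n + 1) * ((n + 2) * RankOne.R n) = (n + 2) * (2 * (2 ^ n * RankOne.R n)) := by ring
        _ ≤ (n + 2) * d n := Nat.mul_le_mul_left _ (by omega)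
  have cmono : StrictMono c := strictMono_nat_of_lt_succ fun n => by
    have h1 := hd2 n
    have h2 := hh2 n
    have h3 := hc (n + 1)
    omega
  have dmono : StrictMono d := strictMono_nat_of_lt_succ fun n => by
    have h1 := hd2 (n + 1)
    have h2 := hh2 n
    have h3 := hc (n + 1)
    omega
  obtain ⟨DS, hS1, hS2⟩ := RankOne.exists_data h d
    (fun n => by have h1 := hd2 n; have h2 := hc n; omega) (fun n => (hh n).ge) big
  obtain ⟨DT, hT1, hT2⟩ := RankOne.exists_data h c hc
    (fun n => by
      have h1 := hd n
      have h2 := hh2 n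
      omega) big
  have zS := fun {A B} => DS.zeroType (A := A) (B := B) c (by
    intro n k j hk hj
    rw [hS1] at hk ⊢
    rw [hS2]
    have h1 := hd2 n
    have h2 := hc n
    have h3 : j * d n + d n ≤ (n + 2) * d n := by
      rw [← Nat.succ_mul]
      exact Nat.mul_le_mul_right _ hj
    refine ⟨by rw [hh]; omega, ?_⟩
    intro k' j' hk' hj' heq
    have e1 : (1 + k + c n + j * d n) % d n = (1 + k' + j' * d n) % d n := by
      rw [← heq]
      congr 1
      ring
    rw [Nat.add_mul_mod_self_right, Nat.add_mul_mod_self_right, Nat.mod_eq_of_lt (by omega),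
      Nat.mod_eq_of_lt (by omega)] at e1
    omega)
  have zT := fun {A B} => DT.zeroType (A := A) (B := B) d (by
    intro n k j hk hj
    rw [hT1] at hk ⊢
    rw [hT2]
    have h1 := hd n
    have h2 := hc n
    have h4 := hh2 n
    have h3 : ∀ j, j < n + 2 → j * c n + c n ≤ (n + 2) * c n := by
      intro j hj
      rw [← Nat.succ_mul]
      exact Nat.mul_le_mul_right _ hj
    have h5 := h3 j hj
    refine ⟨by omega, ?_⟩
    intro k' j' hk' hj' heq
    have h6 := h3 j' hj'
    omega)
  have rS := fun {A} => DS.rigid (A := A)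
  have rT := fun {A} => DT.rigid (A := A)
  rw [hS2] at rS
  rw [hT2] at rT
  refine ⟨Set.range c, Set.range d, Set.range_subset_iff.2 hcC, Set.range_subset_iff.2 hdD,
    Set.infinite_range_of_injective cmono.injective,
    Set.infinite_range_of_injective dmono.injective,
    NNReal, inferInstance, RankOne.vol, inferInstance, RankOne.volume_univ, DS.E, DT.E,
    DS.measurePreserving_S, DT.measurePreserving_S, DS.ergodic_E, DT.ergodic_E, ?_⟩
  intro A B hA hB hA' hB'
  rw [DS.coe_E, DT.coe_E]
  refine ⟨?_, ?_⟩
  · exact RankOne.eps_of_tendsto cmono (u := fun i => RankOne.vol (DS.S^[i] '' A ∩ B))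
      (v := fun i => RankOne.vol ((DT.S^[i] '' A) ∆ A)) (zS hA hB hA'.ne hB'.ne) (rT hA hA'.ne)
  · exact RankOne.eps_of_tendsto dmono (u := fun i => RankOne.vol ((DS.S^[i] '' A) ∆ A))
      (v := fun i => RankOne.vol (DT.S^[i] '' A ∩ B)) (rS hA hA'.ne) (zT hA hB hA'.ne hB'.ne)
end
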